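/- Let L be an ample line bundle on a smooth projective toric surface X whose fan has n ≥ 5 rays ρ_1, ..., ρ_n. Then for every i, L^2 ≥ L·D_{ρ_i} + 4, where D_{ρ_i} is the invariant divisor of ρ_i. -/

import Mathlib

/-- Embedding of lattice points of `ℤ²` into the real plane. -/
def toR (p : ℤ × ℤ) : ℝ × ℝ := ((p.1 : ℝ), (p.2 : ℝ))

/-- The determinant of two plane vectors. -/
def planeDet {R : Type*} [CommRing R] (p q : R × R) : R := p.1 * q.2 - p.2 * q.1

/-- The doubled area of a convex lattice pentagon with vertices `(0, 0)`, `(l, 0)`, `(c₁, c₂)`,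
`(d₁, d₂)`, `(e₁, e₂)` in counterclockwise order is at least `l + 4`. -/
theorem add_four_le_of_pentagon {l c₁ c₂ d₁ d₂ e₁ e₂ : ℤ} (hl : 0 < l) (hc : 0 < c₂) (hd : 0 < d₂)
    (he : 0 < e₂) (hcd : 0 < c₁ * d₂ - c₂ * d₁) (hde : 0 < d₁ * e₂ - d₂ * e₁)
    (hce : 0 < c₁ * e₂ - c₂ * e₁)
    (hbcd : l * d₂ < l * c₂ + (c₁ * d₂ - c₂ * d₁))
    (hbde : l * e₂ < l * d₂ + (d₁ * e₂ - d₂ * e₁))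
    (hcde : c₁ * e₂ - c₂ * e₁ < (c₁ * d₂ - c₂ * d₁) + (d₁ * e₂ - d₂ * e₁)) :
    l + 4 ≤ l * c₂ + (c₁ * d₂ - c₂ * d₁) + (d₁ * e₂ - d₂ * e₁) := by
  have key : ∀ k, l * k + 2 ≤ l * c₂ + (c₁ * d₂ - c₂ * d₁) + (d₁ * e₂ - d₂ * e₁) →
      (2 ≤ k ∧ 2 ≤ l ∨ 3 ≤ k) →
      l + 4 ≤ l * c₂ + (c₁ * d₂ - c₂ * d₁) + (d₁ * e₂ - d₂ * e₁) := by
    rintro k hk (⟨h1, h2⟩ | h) <;> nlinarith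
  have kc := key c₂ (by linarith)
  have kd := key d₂ (by linarith)
  have ke := key e₂ (by linarith)
  by_cases h3 : 3 ≤ c₂ ∨ 3 ≤ d₂ ∨ 3 ≤ e₂
  · rcases h3 with h | h | h
    exacts [kc (.inr h), kd (.inr h), ke (.inr h)]
  push Not at h3
  obtain ⟨hc', hd', he'⟩ := h3
  by_cases hl2 : 2 ≤ l
  · by_cases h2 : 2 ≤ c₂ ∨ 2 ≤ d₂ ∨ 2 ≤ e₂
    · rcases h2 with h | h | h
      exacts [kc (.inl ⟨h, hl2⟩), kd (.inl ⟨h, hl2⟩), ke (.inl ⟨h, hl2⟩)]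
    · obtain rfl : c₂ = 1 := by omega
      obtain rfl : d₂ = 1 := by omega
      obtain rfl : e₂ = 1 := by omega
      omega
  · obtain rfl : l = 1 := by omega
    clear kc kd ke key
    interval_cases c₂ <;> interval_cases d₂ <;> interval_cases e₂ <;> omega

/-- The open standard triangle has area `1 / 2`. -/
theorem volume_open_triangle :
    MeasureTheory.volume {p : ℝ × ℝ | 0 < p.1 ∧ 0 < p.2 ∧ p.1 + p.2 < 1} =
      ENNReal.ofReal (1 / 2) := by
  have h : {p : ℝ × ℝ | 0 < p.1 ∧ 0 < p.2 ∧ p.1 + p.2 < 1} =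
      regionBetween (fun _ => 0) (fun x => 1 - x) (Set.Ioo (0 : ℝ) 1) := by
    ext p
    simp only [regionBetween, Set.mem_ofPred_eq, Set.mem_Ioo]
    constructor
    · rintro ⟨h1, h2, h3⟩
      exact ⟨⟨h1, by linarith⟩, h2, by linarith⟩
    · rintro ⟨⟨h1, _⟩, h2, h3⟩
      exact ⟨h1, h2, by linarith⟩
  rw [h, MeasureTheory.Measure.volume_eq_prod,
    volume_regionBetween_eq_integral (by simp)
      ((by fun_prop : Continuous fun x : ℝ => 1 - x).integrableOn_Icc.mono_set
        Set.Ioo_subset_Icc_self)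
      measurableSet_Ioo (fun x hx => by linarith [hx.2])]
  congr 1
  rw [← MeasureTheory.integral_Ioc_eq_integral_Ioo, ← intervalIntegral.integral_of_le zero_le_one]
  simp only [Pi.sub_apply, sub_zero]
  rw [intervalIntegral.integral_sub (by simp) (by simp)]
  simp
  norm_num

/-- The linear map sending the standard basis of the plane to `X`, `Y`. -/
noncomputable def ofColumns (X Y : ℝ × ℝ) : (ℝ × ℝ) →ₗ[ℝ] (ℝ × ℝ) :=
  (LinearMap.fst ℝ ℝ ℝ).smulRight X + (LinearMap.snd ℝ ℝ ℝ).smulRight Y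

theorem ofColumns_apply (X Y p : ℝ × ℝ) : ofColumns X Y p = p.1 • X + p.2 • Y := rfl

theorem det_ofColumns (X Y : ℝ × ℝ) : LinearMap.det (ofColumns X Y) = planeDet X Y := by
  rw [← LinearMap.det_toMatrix (Module.Basis.finTwoProd ℝ), Matrix.det_fin_two]
  simp [LinearMap.toMatrix_apply, ofColumns_apply, planeDet]
  ring

/-- The open triangle with vertices `0`, `X`, `Y`. -/
def openTriangle (X Y : ℝ × ℝ) : Set (ℝ × ℝ) :=
  ofColumns X Y '' {p | 0 < p.1 ∧ 0 < p.2 ∧ p.1 + p.2 < 1}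

theorem volume_openTriangle {X Y : ℝ × ℝ} (h : 0 < planeDet X Y) :
    MeasureTheory.volume (openTriangle X Y) = ENNReal.ofReal (planeDet X Y / 2) := by
  rw [openTriangle, MeasureTheory.Measure.addHaar_image_linearMap, det_ofColumns, abs_of_pos h,
    volume_open_triangle, ← ENNReal.ofReal_mul h.le]
  congr 1
  ring

theorem openTriangle_subset {P : Set (ℝ × ℝ)} (hP : Convex ℝ P) (h0 : (0 : ℝ × ℝ) ∈ P)
    {X Y : ℝ × ℝ} (hX : X ∈ P) (hY : Y ∈ P) : openTriangle X Y ⊆ P := by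
  rintro _ ⟨p, ⟨h1, h2, h3⟩, rfl⟩
  rw [ofColumns_apply]
  have := hP.sum_mem (t := Finset.univ) (w := ![1 - p.1 - p.2, p.1, p.2]) (z := ![0, X, Y])
    (by intro i _; fin_cases i <;> simp <;> linarith)
    (by simp [Fin.sum_univ_three]; ring) (by intro i _; fin_cases i <;> simpa)
  simpa [Fin.sum_univ_three] using this

theorem planeDet_pos_of_mem_openTriangle {D X Y p : ℝ × ℝ} (hX : 0 ≤ planeDet D X)
    (hY : 0 < planeDet D Y)
    (hp : p ∈ openTriangle X Y) : 0 < planeDet D p := by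
  obtain ⟨q, ⟨h1, h2, h3⟩, rfl⟩ := hp
  have : planeDet D (ofColumns X Y q) = q.1 * planeDet D X + q.2 * planeDet D Y := by
    simp [planeDet, ofColumns_apply]
    ring
  rw [this]
  positivity

theorem planeDet_neg_of_mem_openTriangle {D X Y p : ℝ × ℝ} (hX : planeDet D X < 0)
    (hY : planeDet D Y ≤ 0)
    (hp : p ∈ openTriangle X Y) : planeDet D p < 0 := by
  obtain ⟨q, ⟨h1, h2, h3⟩, rfl⟩ := hp
  have : planeDet D (ofColumns X Y q) = q.1 * planeDet D X + q.2 * planeDet D Y := by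
    simp [planeDet, ofColumns_apply]
    ring
  rw [this]
  nlinarith

theorem planeDet_self (X : ℝ × ℝ) : planeDet X X = 0 := by
  simp [planeDet, mul_comm]

theorem planeDet_swap (X Y : ℝ × ℝ) : planeDet X Y = -planeDet Y X := by
  simp only [planeDet]
  ring

/-- Area of a convex set splits along the line through `0` and `D`. -/
theorem add_volume_le {P S T : Set (ℝ × ℝ)} (D : ℝ × ℝ) (hS : S ⊆ P) (hT : T ⊆ P)
    (hS' : ∀ p ∈ S, planeDet D p ≤ 0) (hT' : ∀ p ∈ T, 0 < planeDet D p) :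
    MeasureTheory.volume S + MeasureTheory.volume T ≤ MeasureTheory.volume P := by
  have hm : MeasurableSet {p : ℝ × ℝ | 0 < planeDet D p} := by
    apply measurableSet_lt measurable_const
    unfold planeDet
    fun_prop
  rw [← MeasureTheory.measure_inter_add_sdiff P hm, add_comm]
  exact add_le_add (MeasureTheory.measure_mono fun p hp => ⟨hT hp, hT' p hp⟩)
    (MeasureTheory.measure_mono fun p hp => ⟨hS hp, not_lt.2 (hS' p hp)⟩)

/-- A convex set containing `0, B, C, D, E` has at least the area of the fan of triangles
from `0`. -/
theorem fan_le_volume {P : Set (ℝ × ℝ)} (hP : Convex ℝ P) (hfin : MeasureTheory.volume P ≠ ⊤)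
    {B C D E : ℝ × ℝ} (h0 : (0 : ℝ × ℝ) ∈ P) (hB : B ∈ P) (hC : C ∈ P) (hD : D ∈ P) (hE : E ∈ P)
    (hBC : 0 < planeDet B C) (hBD : 0 < planeDet B D) (hCD : 0 < planeDet C D)
    (hDE : 0 < planeDet D E) :
    planeDet B C + planeDet C D + planeDet D E ≤ 2 * (MeasureTheory.volume P).toReal := by
  have hDB : planeDet D B < 0 := by rw [planeDet_swap]; linarith
  have hDC : planeDet D C < 0 := by rw [planeDet_swap]; linarith
  have hCB : planeDet C B < 0 := by rw [planeDet_swap]; linarith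
  have h1 := openTriangle_subset hP h0 hB hC
  have h2 := openTriangle_subset hP h0 hC hD
  have h3 := openTriangle_subset hP h0 hD hE
  have s1 := add_volume_le (P := openTriangle B C ∪ openTriangle C D) C
    Set.subset_union_left Set.subset_union_right
    (fun p hp => (planeDet_neg_of_mem_openTriangle hCB (planeDet_self C).le hp).le)
    (fun p hp => planeDet_pos_of_mem_openTriangle (planeDet_self C).ge hCD hp)
  have s2 := add_volume_le D (Set.union_subset h1 h2) h3
    (by
      rintro p (hp | hp)
      · exact (planeDet_neg_of_mem_openTriangle hDB hDC.le hp).le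
      · exact (planeDet_neg_of_mem_openTriangle hDC (planeDet_self D).le hp).le)
    (fun p hp => planeDet_pos_of_mem_openTriangle (planeDet_self D).ge hDE hp)
  have s := (add_le_add_left s1 _).trans s2
  rw [volume_openTriangle hBC, volume_openTriangle hCD, volume_openTriangle hDE,
    ← ENNReal.ofReal_add (by positivity) (by positivity),
    ← ENNReal.ofReal_add (by positivity) (by positivity), ENNReal.ofReal_le_iff_le_toReal hfin] at s
  linarith

theorem planeDet_sub_ne_zero_of_mem_extremePoints {P : Set (ℝ × ℝ)}
    {A X Y : ℝ × ℝ} (hA : A ∈ P.extremePoints ℝ)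
    (hX : X ∈ P.extremePoints ℝ) (hY : Y ∈ P.extremePoints ℝ) (hAX : A ≠ X) (hAY : A ≠ Y)
    (hXY : X ≠ Y) : planeDet (X - A) (Y - A) ≠ 0 := by
  intro h
  have hbtw : ∀ {x y z : ℝ × ℝ}, x ∈ P.extremePoints ℝ → y ∈ P.extremePoints ℝ →
      z ∈ P.extremePoints ℝ → Wbtw ℝ x y z → y = x ∨ y = z := by
    intro x y z hx hy hz hw
    have := (mem_extremePoints_iff_forall_segment.1 hy).2 x hx.1 z hz.1
      (mem_segment_iff_wbtw.2 hw)
    tauto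
  have hcol : Collinear ℝ {A, X, Y} := by
    rw [collinear_iff_of_mem (p₀ := A) (by simp)]
    have hne : X - A ≠ 0 := sub_ne_zero.2 hAX.symm
    refine ⟨X - A, ?_⟩
    rintro p (rfl | rfl | rfl)
    · exact ⟨0, by simp⟩
    · exact ⟨1, by simp⟩
    · generalize hU : X - A = U at h hne
      generalize hV : p - A = V at h
      have hpV : p = V + A := by rw [← hV]; simp
      have : ∃ r : ℝ, V = r • U := by
        simp only [planeDet] at h
        by_cases h1 : U.1 = 0
        · have h2 : U.2 ≠ 0 := fun h2 => hne (Prod.ext h1 h2)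
          refine ⟨V.2 / U.2, Prod.ext ?_ ?_⟩
          · simp only [h1, zero_mul, zero_sub, neg_eq_zero, mul_eq_zero, h2, false_or] at h
            simp [h1, h]
          · simp [h2]
        · refine ⟨V.1 / U.1, Prod.ext ?_ ?_⟩
          · simp [h1]
          · simp only [Prod.smul_snd, smul_eq_mul]
            field_simp
            linarith
      obtain ⟨r, rfl⟩ := this
      exact ⟨r, by simp [hpV]⟩
  rcases hcol.wbtw_or_wbtw_or_wbtw with h | h | h
  · rcases hbtw hA hX hY h with h | h
    exacts [hAX h.symm, hXY h]
  · rcases hbtw hX hY hA h with h | h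
    exacts [hXY h.symm, hAY h.symm]
  · rcases hbtw hY hA hX h with h | h
    exacts [hAY h, hAX h]

/-- If `Y` lies angularly between `X` and `Z` as seen from `A`, then `Y` lies beyond the line
`XZ`. -/
theorem planeDet_lt_add_planeDet {P : Set (ℝ × ℝ)} (hP : Convex ℝ P) {A X Y Z : ℝ × ℝ} (hA : A ∈ P)
    (hX : X ∈ P) (hY : Y ∈ P.extremePoints ℝ) (hZ : Z ∈ P)
    (hXY : 0 < planeDet (X - A) (Y - A)) (hYZ : 0 < planeDet (Y - A) (Z - A))
    (hXZ : 0 < planeDet (X - A) (Z - A)) :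
    planeDet (X - A) (Z - A) < planeDet (X - A) (Y - A) + planeDet (Y - A) (Z - A) := by
  by_contra! hle
  set a := planeDet (X - A) (Y - A) with ha
  set b := planeDet (Y - A) (Z - A) with hb
  set c := planeDet (X - A) (Z - A) with hc
  -- `Y` lies strictly between `X` and a point of the segment `AZ`
  have hbc : b < c := by linarith
  have hW : A + (a / (c - b)) • (Z - A) ∈ P := by
    refine hP.add_smul_sub_mem hA hZ ⟨div_nonneg hXY.le (by linarith), ?_⟩
    rw [div_le_one (by linarith)]
    linarith
  have hopen : Y ∈ openSegment ℝ X (A + (a / (c - b)) • (Z - A)) := by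
    refine ⟨b / c, (c - b) / c, by positivity, div_pos (by linarith) hXZ, by field_simp; ring, ?_⟩
    have hcb : c - b ≠ 0 := by linarith
    have e1 : c * (Y.1 - A.1) = b * (X.1 - A.1) + a * (Z.1 - A.1) := by
      simp only [ha, hb, hc, planeDet, Prod.fst_sub, Prod.snd_sub]; ring
    have e2 : c * (Y.2 - A.2) = b * (X.2 - A.2) + a * (Z.2 - A.2) := by
      simp only [ha, hb, hc, planeDet, Prod.fst_sub, Prod.snd_sub]; ring
    ext
    · simp only [Prod.fst_add, Prod.smul_fst, Prod.fst_sub, smul_eq_mul]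
      field_simp
      linarith
    · simp only [Prod.snd_add, Prod.smul_snd, Prod.snd_sub, smul_eq_mul]
      field_simp
      linarith
  have := (mem_extremePoints.1 hY).2 X hX _ hW hopen
  rw [← this.1] at ha
  rw [ha, planeDet_self] at hXY
  exact lt_irrefl _ hXY

/-- A segment in the boundary of a convex body spans a supporting line. -/
theorem planeDet_nonneg_or_nonpos {P : Set (ℝ × ℝ)} (hP : Convex ℝ P) (hint : (interior P).Nonempty)
    {A B : ℝ × ℝ} (hA : A ∈ P) (hB : B ∈ P) (hAB : segment ℝ A B ⊆ frontier P) :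
    (∀ p ∈ P, 0 ≤ planeDet (B - A) (p - A)) ∨ (∀ p ∈ P, planeDet (B - A) (p - A) ≤ 0) := by
  have hmid := hAB (midpoint_mem_segment A B)
  obtain ⟨f, hf⟩ := geometric_hahn_banach_open_point hP.interior isOpen_interior hmid.2
  have hle : ∀ p ∈ P, f p ≤ f (midpoint ℝ A B) := by
    have : P ⊆ closure (interior P) := by
      rw [hP.closure_interior_eq_closure_of_nonempty_interior hint]
      exact subset_closure
    intro p hp
    exact closure_minimal (fun q hq => (hf q hq).le)
      (isClosed_le f.continuous continuous_const) (this hp)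
  obtain ⟨q, hq⟩ := hint
  have hmA : f (midpoint ℝ A B) = (f A + f B) / 2 := by
    rw [midpoint_eq_smul_add]
    simp
    ring
  have hfA := hle A hA
  have hfB := hle B hB
  have hfAB : f A = f B := by linarith
  have hfm : f (midpoint ℝ A B) = f A := by linarith
  have hfq := hf q hq
  rw [hfm] at hle hfq
  set α := f (1, 0)
  set β := f (0, 1)
  have hlin : ∀ p : ℝ × ℝ, f p = p.1 * α + p.2 * β := by
    intro p
    have : p = p.1 • ((1 : ℝ), (0 : ℝ)) + p.2 • ((0 : ℝ), (1 : ℝ)) := by ext <;> simp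
    conv_lhs => rw [this]
    simp only [map_add, map_smul, smul_eq_mul, α, β]
  have hne : α ≠ 0 ∨ β ≠ 0 := by
    by_contra! h
    simp [hlin, h.1, h.2] at hfq
  have hdir : α * (B.1 - A.1) + β * (B.2 - A.2) = 0 := by
    rw [hlin, hlin] at hfAB
    linarith
  have hpos : 0 < α ^ 2 + β ^ 2 := by
    rcases hne with h | h <;> positivity
  have hid : ∀ p : ℝ × ℝ, (α ^ 2 + β ^ 2) * planeDet (B - A) (p - A) =
      (α * (B.2 - A.2) - β * (B.1 - A.1)) * (f A - f p) := by
    intro p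
    rw [hlin, hlin]
    simp only [planeDet, Prod.fst_sub, Prod.snd_sub]
    linear_combination (α * (p.2 - A.2) - β * (p.1 - A.1)) * hdir
  rcases le_total 0 (α * (B.2 - A.2) - β * (B.1 - A.1)) with h | h
  · refine .inl fun p hp => ?_
    have := hle p hp
    have h2 := mul_nonneg h (sub_nonneg.2 this)
    rw [← hid] at h2
    exact nonneg_of_mul_nonneg_right h2 hpos
  · refine .inr fun p hp => ?_
    have := hle p hp
    have h2 := mul_nonpos_of_nonpos_of_nonneg h (sub_nonneg.2 this)
    rw [← hid] at h2
    exact nonpos_of_mul_nonpos_right h2 hpos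

theorem toR_injective : Function.Injective toR := by
  intro p q h
  simpa [toR, Prod.ext_iff] using h

theorem planeDet_toR_sub (A X Y : ℤ × ℤ) :
    planeDet (toR X - toR A) (toR Y - toR A) = (planeDet (X - A) (Y - A) : ℤ) := by
  simp [planeDet, toR]

/-- A lattice segment is an integer multiple `l` of a primitive vector `u`, and it has at
most `l + 1` lattice points. -/
theorem exists_primitive {A B : ℤ × ℤ} (hAB : A ≠ B) :
    ∃ (l : ℤ) (u w : ℤ × ℤ), 0 < l ∧ B - A = l • u ∧ planeDet w u = 1 ∧
      ({m : ℤ × ℤ | toR m ∈ segment ℝ (toR A) (toR B)}.ncard : ℤ) ≤ l + 1 := by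
  have hne : B - A ≠ 0 := sub_ne_zero.2 hAB.symm
  have hpos : 0 < Int.gcd (B - A).1 (B - A).2 := by
    rw [Int.gcd_pos_iff]
    by_contra! h
    exact hne (Prod.ext h.1 h.2)
  obtain ⟨u₁, u₂, hco, h1, h2⟩ := Int.exists_gcd_one hpos
  set g := Int.gcd (B - A).1 (B - A).2
  obtain ⟨x, y, hxy⟩ := Int.isCoprime_iff_gcd_eq_one.2 hco
  refine ⟨g, (u₁, u₂), (y, -x), by exact_mod_cast hpos, ?_, ?_, ?_⟩
  · ext
    · simp [h1, mul_comm]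
    · simp [h2, mul_comm]
  · simp only [planeDet]
    linarith
  · have hsub : {m : ℤ × ℤ | toR m ∈ segment ℝ (toR A) (toR B)} ⊆
        (fun j : ℤ => A + j • (u₁, u₂)) '' (Finset.Icc (0 : ℤ) g : Finset ℤ) := by
      intro m hm
      rw [Set.mem_ofPred_eq, segment_eq_image'] at hm
      obtain ⟨t, ⟨ht0, ht1⟩, hm⟩ := hm
      have k1 : (B.1 : ℝ) - A.1 = u₁ * g := by exact_mod_cast h1
      have k2 : (B.2 : ℝ) - A.2 = u₂ * g := by exact_mod_cast h2
      have hgpos : (0 : ℝ) < g := by exact_mod_cast hpos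
      have m1 : (m.1 : ℝ) = A.1 + t * (u₁ * g) := by
        rw [← k1]; simpa [toR] using (congrArg Prod.fst hm).symm
      have m2 : (m.2 : ℝ) = A.2 + t * (u₂ * g) := by
        rw [← k2]; simpa [toR] using (congrArg Prod.snd hm).symm
      have hxy' : (x : ℝ) * u₁ + y * u₂ = 1 := by exact_mod_cast hxy
      have hj : ((x * (m.1 - A.1) + y * (m.2 - A.2) : ℤ) : ℝ) = t * g := by
        push_cast
        rw [m1, m2]
        linear_combination t * g * hxy'
      refine ⟨x * (m.1 - A.1) + y * (m.2 - A.2), ?_, ?_⟩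
      · simp only [Finset.coe_Icc, Set.mem_Icc]
        constructor
        · have : (0 : ℝ) ≤ ((x * (m.1 - A.1) + y * (m.2 - A.2) : ℤ) : ℝ) := by
            rw [hj]; positivity
          exact_mod_cast this
        · have : ((x * (m.1 - A.1) + y * (m.2 - A.2) : ℤ) : ℝ) ≤ g := by
            rw [hj]; nlinarith
          exact_mod_cast this
      · apply toR_injective
        ext
        · simp only [toR, Prod.fst_add, Prod.smul_fst, smul_eq_mul]
          rw [Int.cast_add, Int.cast_mul, hj, m1]
          ring
        · simp only [toR, Prod.snd_add, Prod.smul_snd, smul_eq_mul]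
          rw [Int.cast_add, Int.cast_mul, hj, m2]
          ring
    have := (Set.ncard_le_ncard hsub (Set.toFinite _)).trans
      (Set.ncard_image_le (Set.toFinite _))
    rw [Set.ncard_coe_finset, Int.card_Icc] at this
    omega

/-- Three pairwise non-parallel vectors in an open half plane can be sorted by angle. -/
theorem exists_angular_order {S : Set (ℤ × ℤ)} {U : ℤ × ℤ} (hU : ∀ X ∈ S, 0 < planeDet U X)
    (hne : ∀ X ∈ S, ∀ Y ∈ S, X ≠ Y → planeDet X Y ≠ 0) {X Y Z : ℤ × ℤ} (hX : X ∈ S) (hY : Y ∈ S)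
    (hZ : Z ∈ S) (hXY : X ≠ Y) (hXZ : X ≠ Z) (hYZ : Y ≠ Z) :
    ∃ C ∈ S, ∃ D ∈ S, ∃ E ∈ S, 0 < planeDet C D ∧ 0 < planeDet D E ∧ 0 < planeDet C E := by
  have swap : ∀ V W : ℤ × ℤ, planeDet V W = -planeDet W V := by
    intro V W
    simp only [planeDet]
    ring
  have trans : ∀ {V W T : ℤ × ℤ}, V ∈ S → W ∈ S → T ∈ S → 0 < planeDet V W → 0 < planeDet W T →
      0 < planeDet V T := by
    intro V W T hV hW hT h1 h2
    have e : planeDet U W * planeDet V T =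
        planeDet U V * planeDet W T + planeDet V W * planeDet U T := by
      simp only [planeDet]
      ring
    have h3 := add_pos (mul_pos (hU V hV) h2) (mul_pos h1 (hU T hT))
    rw [← e] at h3
    exact pos_of_mul_pos_right h3 (hU W hW).le
  have dich : ∀ {V W : ℤ × ℤ}, V ∈ S → W ∈ S → V ≠ W → 0 < planeDet V W ∨ 0 < planeDet W V := by
    intro V W hV hW h
    have := hne V hV W hW h
    have := swap V W
    omega
  have of_lt : ∀ {V W T : ℤ × ℤ}, V ∈ S → W ∈ S → T ∈ S → 0 < planeDet V W → 0 < planeDet W T →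
      ∃ C ∈ S, ∃ D ∈ S, ∃ E ∈ S, 0 < planeDet C D ∧ 0 < planeDet D E ∧ 0 < planeDet C E :=
    fun hV hW hT h1 h2 => ⟨_, hV, _, hW, _, hT, h1, h2, trans hV hW hT h1 h2⟩
  rcases dich hX hY hXY with h1 | h1 <;> rcases dich hY hZ hYZ with h2 | h2 <;>
    rcases dich hX hZ hXZ with h3 | h3
  · exact of_lt hX hY hZ h1 h2
  · exact of_lt hX hY hZ h1 h2
  · exact of_lt hX hZ hY h3 h2
  · exact of_lt hZ hX hY h3 h1
  · exact of_lt hY hX hZ h1 h3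
  · exact of_lt hY hZ hX h2 h3
  · exact of_lt hZ hY hX h2 h1
  · exact of_lt hZ hY hX h2 h1

/-- The area bound for a convex set with five lattice extreme points lying to the left of the
line through two of them. -/
theorem ncard_segment_add_three_le {P : Set (ℝ × ℝ)} (hP : Convex ℝ P)
    (hfin : MeasureTheory.volume P ≠ ⊤) {A B X Y Z : ℤ × ℤ}
    (hA : toR A ∈ P.extremePoints ℝ) (hB : toR B ∈ P.extremePoints ℝ)
    (hX : toR X ∈ P.extremePoints ℝ) (hY : toR Y ∈ P.extremePoints ℝ)
    (hZ : toR Z ∈ P.extremePoints ℝ) (hnodup : [A, B, X, Y, Z].Nodup)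
    (hside : ∀ p ∈ P, 0 ≤ planeDet (toR B - toR A) (p - toR A)) :
    ({m : ℤ × ℤ | toR m ∈ segment ℝ (toR A) (toR B)}.ncard : ℝ) + 3 ≤
      2 * (MeasureTheory.volume P).toReal := by
  simp only [List.nodup_cons, List.mem_cons, List.not_mem_nil, or_false, not_or,
    not_false_eq_true, List.nodup_nil, and_true] at hnodup
  obtain ⟨⟨hAB, hAX, hAY, hAZ⟩, ⟨hBX, hBY, hBZ⟩, ⟨hXY, hXZ⟩, hYZ⟩ := hnodup
  have hne : ∀ {V W : ℤ × ℤ}, toR V ∈ P.extremePoints ℝ → toR W ∈ P.extremePoints ℝ →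
      A ≠ V → A ≠ W → V ≠ W → planeDet (V - A) (W - A) ≠ 0 := by
    intro V W hV hW h1 h2 h3 h
    refine planeDet_sub_ne_zero_of_mem_extremePoints hA hV hW
      (toR_injective.ne h1) (toR_injective.ne h2) (toR_injective.ne h3) ?_
    rw [planeDet_toR_sub, h, Int.cast_zero]
  let S : Set (ℤ × ℤ) := {V | toR (V + A) ∈ P.extremePoints ℝ ∧ V + A ≠ A ∧ V + A ≠ B}
  have hmem : ∀ V : ℤ × ℤ, toR V ∈ P.extremePoints ℝ → A ≠ V → B ≠ V → V - A ∈ S := by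
    intro V hV h1 h2
    simpa [S, sub_eq_zero] using ⟨hV, h1.symm, h2.symm⟩
  have hU : ∀ V ∈ S, 0 < planeDet (B - A) V := by
    rintro V ⟨h1, h2, h3⟩
    have h4 := hside _ h1.1
    rw [planeDet_toR_sub] at h4
    have h5 := hne hB h1 hAB h2.symm h3.symm
    rw [add_sub_cancel_right] at h4 h5
    have : 0 ≤ planeDet (B - A) V := by exact_mod_cast h4
    omega
  obtain ⟨C, hC, D, hD, E, hE, hCD, hDE, hCE⟩ := exists_angular_order hU
    (by
      rintro V ⟨h1, h2, h3⟩ W ⟨h4, h5, h6⟩ h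
      simpa using hne h1 h4 h2.symm h5.symm (by simpa using h))
    (hmem X hX hAX hBX) (hmem Y hY hAY hBY) (hmem Z hZ hAZ hBZ)
    (by simpa using hXY) (by simpa using hXZ) (by simpa using hYZ)
  have hBC := hU C hC
  have hBD := hU D hD
  have hBE := hU E hE
  have cast_planeDet : ∀ V W : ℤ × ℤ,
      planeDet (toR (V + A) - toR A) (toR (W + A) - toR A) = (planeDet V W : ℤ) := by
    intro V W
    rw [planeDet_toR_sub, add_sub_cancel_right, add_sub_cancel_right]
  have hconv : ∀ {V W T : ℤ × ℤ}, toR (V + A) ∈ P → W ∈ S → T ∈ S → 0 < planeDet V W →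
      0 < planeDet W T → 0 < planeDet V T → planeDet V T < planeDet V W + planeDet W T := by
    intro V W T hV hW hT h1 h2 h3
    have := planeDet_lt_add_planeDet hP hA.1 hV hW.1 hT.1.1
      (by rw [planeDet_toR_sub]; simpa using h1) (by rw [planeDet_toR_sub]; simpa using h2)
      (by rw [planeDet_toR_sub]; simpa using h3)
    rw [cast_planeDet, cast_planeDet, cast_planeDet] at this
    exact_mod_cast this
  have hB' : toR (B - A + A) ∈ P := by simpa using hB.1
  have hBCD := hconv hB' hC hD hBC hCD hBD
  have hBDE := hconv hB' hD hE hBD hDE hBE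
  have hCDE := hconv hC.1.1 hD hE hCD hDE hCE
  have harea : (planeDet (B - A) C + planeDet C D + planeDet D E : ℤ) ≤
      2 * (MeasureTheory.volume P).toReal := by
    have hvol : MeasureTheory.volume ((fun p => toR A + p) ⁻¹' P) = MeasureTheory.volume P :=
      MeasureTheory.measure_preimage_add _ _ _
    have := fan_le_volume (P := (fun p => toR A + p) ⁻¹' P) (hP.translate_preimage_right _)
      (by rwa [hvol]) (B := toR (B - A + A) - toR A) (C := toR (C + A) - toR A)
      (D := toR (D + A) - toR A) (E := toR (E + A) - toR A) (by simpa using hA.1)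
      (by simpa using hB.1) (by simpa using hC.1.1) (by simpa using hD.1.1) (by simpa using hE.1.1)
      (by rw [cast_planeDet]; exact_mod_cast hBC) (by rw [cast_planeDet]; exact_mod_cast hBD)
      (by rw [cast_planeDet]; exact_mod_cast hCD) (by rw [cast_planeDet]; exact_mod_cast hDE)
    rw [hvol, cast_planeDet, cast_planeDet, cast_planeDet] at this
    exact_mod_cast this
  obtain ⟨l, u, w, hl, hu, hw, hcard⟩ := exists_primitive hAB
  rw [hu] at hBC hBD hBE hBCD hBDE harea
  have smul_planeDet : ∀ V : ℤ × ℤ, planeDet (l • u) V = l * planeDet u V := by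
    intro V
    simp only [planeDet, Prod.smul_fst, Prod.smul_snd, smul_eq_mul]
    ring
  -- `(w, u)` is unimodular, so `V ↦ (planeDet w V, planeDet u V)` preserves determinants
  have coord : ∀ V W : ℤ × ℤ,
      planeDet V W = planeDet w V * planeDet u W - planeDet u V * planeDet w W := by
    intro V W
    have : planeDet w V * planeDet u W - planeDet u V * planeDet w W =
        planeDet w u * planeDet V W := by
      simp only [planeDet]
      ring
    rw [this, hw, one_mul]
  rw [smul_planeDet] at hBC hBD hBE
  simp only [smul_planeDet] at hBCD hBDE harea
  have hfinal : l + 4 ≤ l * planeDet u C + planeDet C D + planeDet D E := by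
    rw [coord C D] at hCD hBCD hCDE ⊢
    rw [coord D E] at hDE hBDE hCDE ⊢
    rw [coord C E] at hCE hCDE
    exact add_four_le_of_pentagon hl (pos_of_mul_pos_right hBC hl.le)
      (pos_of_mul_pos_right hBD hl.le) (pos_of_mul_pos_right hBE hl.le) hCD hDE hCE hBCD hBDE hCDE
  have hcard' : (({m : ℤ × ℤ | toR m ∈ segment ℝ (toR A) (toR B)}.ncard + 3 : ℤ) : ℝ) ≤
      (l * planeDet u C + planeDet C D + planeDet D E : ℤ) := by
    exact_mod_cast (by omega)
  have := hcard'.trans harea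
  exact_mod_cast this

/-- Combinatorial translation of: if `L` is an ample line bundle on a smooth projective
toric surface whose fan has `n ≥ 5` rays, then `L² ≥ L·D_{ρ_i} + 4` for every ray.
Here `L` corresponds to its lattice polygon `P` with `n` vertices `v 0, …, v (n-1)`
(one edge per ray), `L² = 2·area(P)`, and `L·D_{ρ_i} = a i` is the lattice length of
the `i`-th edge. -/
theorem stmt13 (n : ℕ) [NeZero n] (hn : 5 ≤ n) (v : Fin n → ℤ × ℤ)
    (P : Set (ℝ × ℝ)) (hP : P = convexHull ℝ (Set.range (toR ∘ v)))
    (hdim : (interior P).Nonempty)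
    (hinj : Function.Injective v)
    (hvert : ∀ i, toR (v i) ∈ Set.extremePoints ℝ P)
    (hedge : ∀ i : Fin n, segment ℝ (toR (v i)) (toR (v (i + 1))) ⊆ frontier P)
    (a : Fin n → ℤ)
    (ha : ∀ i : Fin n,
      a i = ({m : ℤ × ℤ | toR m ∈ segment ℝ (toR (v i)) (toR (v (i + 1)))}.ncard : ℤ) - 1)
    (hample : ∀ i, 1 ≤ a i)
    (i : Fin n) :
    ((a i : ℝ)) + 4 ≤ 2 * (MeasureTheory.volume P).toReal := by
  have hne : i ≠ i + 1 := by
    intro h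
    have h1 : (1 : Fin n) = 0 := by simpa using h.symm
    have := Fin.one_eq_zero_iff.1 h1
    omega
  obtain ⟨j, k, m, hjkm⟩ : ∃ j k m : Fin n, [i, i + 1, j, k, m].Nodup := by
    have hcard : 3 ≤ (({i, i + 1} : Finset (Fin n))ᶜ).card := by
      rw [Finset.card_compl, Finset.card_pair hne, Fintype.card_fin]
      omega
    obtain ⟨j, k, m, hj, hk, hm, hjk, hjm, hkm⟩ := Finset.two_lt_card_iff.1 hcard
    simp only [Finset.mem_compl, Finset.mem_insert, Finset.mem_singleton, not_or] at hj hk hm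
    refine ⟨j, k, m, ?_⟩
    simp only [List.nodup_cons, List.mem_cons, List.not_mem_nil, or_false, not_or,
      not_false_eq_true, List.nodup_nil, and_true]
    tauto
  have hconv : Convex ℝ P := hP ▸ convex_convexHull ℝ _
  have hfin : MeasureTheory.volume P ≠ ⊤ := by
    rw [hP]
    exact ((Set.finite_range (toR ∘ v)).isCompact_convexHull ℝ).measure_lt_top.ne
  have hnodup := hjkm.map hinj
  have hbound : ({m : ℤ × ℤ | toR m ∈ segment ℝ (toR (v i)) (toR (v (i + 1)))}.ncard : ℝ) + 3 ≤
      2 * (MeasureTheory.volume P).toReal := by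
    rcases planeDet_nonneg_or_nonpos hconv hdim (hvert i).1 (hvert (i + 1)).1 (hedge i) with h | h
    · exact ncard_segment_add_three_le hconv hfin (hvert i) (hvert (i + 1)) (hvert j) (hvert k)
        (hvert m) hnodup h
    · rw [segment_symm]
      refine ncard_segment_add_three_le hconv hfin (hvert (i + 1)) (hvert i) (hvert j) (hvert k)
        (hvert m) ((List.Perm.swap _ _ _).nodup_iff.1 hnodup) fun p hp => ?_
      have := h p hp
      simp only [planeDet, Prod.fst_sub, Prod.snd_sub] at this ⊢
      linarith
  rw [ha i]
  push_cast
  linarith
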